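/- For m ≥ 3 alternatives and n ≥ 3 voters, every even-chance SDS on weak preference profiles that is ex post efficient and weakly strategyproof is dictatorial or bidictatorial: there exist one or two voters such that in every profile, the returned choice set is contained in the union of those voters' sets of top alternatives. -/

import Mathlib

open Classical Finset

/-- A weak preference relation: complete and transitive. -/
structure WeakPref (A : Type*) where
  rel : A → A → Prop
  total : ∀ a b, rel a b ∨ rel b a
  trans : ∀ {a b c}, rel a b → rel b c → rel a c

variable {A V : Type*} [Fintype A] [Fintype V]

/-- Probability of the upper contour set of `x` under the uniform lottery over `X`. -/
noncomputable def setProb (X : Finset A) (r : A → A → Prop) (x : A) : ℝ :=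
  ((X.filter (fun y => r y x)).card : ℝ) / (X.card : ℝ)

/-- The uniform lottery over `X` (weakly) stochastically dominates the one over `Y`. -/
def SDset (r : A → A → Prop) (X Y : Finset A) : Prop :=
  ∀ x, setProb Y r x ≤ setProb X r x

def StrictSDset (r : A → A → Prop) (X Y : Finset A) : Prop :=
  SDset r X Y ∧ ∃ x, setProb Y r x < setProb X r x

/-- The set of most preferred alternatives of the weak order `r`. -/
noncomputable def tops (r : A → A → Prop) : Finset A :=
  Finset.univ.filter (fun x => ∀ y, r x y)

/-- Weak strategyproofness of an even-chance SDS (viewed as a set-valued rule). -/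
def WeakSPset (f : (V → WeakPref A) → Finset A) : Prop :=
  ∀ R R' : V → WeakPref A, ∀ i : V,
    (∀ j, j ≠ i → R j = R' j) → ¬ StrictSDset (R i).rel (f R') (f R)

/-- Ex post efficiency: no Pareto-dominated alternative is ever chosen. -/
def ExPostEffSet (f : (V → WeakPref A) → Finset A) : Prop :=
  ∀ (R : V → WeakPref A) (y : A),
    (∃ x, (∀ i, (R i).rel x y) ∧ (∃ i, ¬ (R i).rel y x)) → y ∉ f R

/-- A coalition `G` is decisive: whenever all its members report the same preference
relation, the choice set is a subset of their common top alternatives. -/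
def Decisive (f : (V → WeakPref A) → Finset A) (G : Finset V) : Prop :=
  ∀ R : V → WeakPref A, (∀ i ∈ G, ∀ j ∈ G, R i = R j) →
    ∀ i ∈ G, f R ⊆ tops (R i).rel

/-- A coalition `G` is nominating: whenever all its members report the same preference
relation, the choice set intersects their common top alternatives. -/
def Nominating (f : (V → WeakPref A) → Finset A) (G : Finset V) : Prop :=
  ∀ R : V → WeakPref A, (∀ i ∈ G, ∀ j ∈ G, R i = R j) →
    ∀ i ∈ G, (f R ∩ tops (R i).rel).Nonempty


/-! ### Uniform lotteries -/

/-- Probability of `T` under the uniform lottery over `X`. -/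
noncomputable def lotteryProb {α : Type*} (X T : Finset α) : ℝ := ((X ∩ T).card : ℝ) / (X.card : ℝ)

/-- Upper contour set of `x`. -/
noncomputable def upperSet (r : A → A → Prop) (x : A) : Finset A :=
  Finset.univ.filter (fun y => r y x)

theorem mem_upperSet {r : A → A → Prop} {x y : A} : y ∈ upperSet r x ↔ r y x := by
  simp [upperSet]

theorem mem_tops {r : A → A → Prop} {x : A} : x ∈ tops r ↔ ∀ y, r x y := by
  simp [tops]

theorem setProb_eq (X : Finset A) (r : A → A → Prop) (x : A) :
    setProb X r x = lotteryProb X (upperSet r x) := by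
  unfold setProb lotteryProb
  congr 3
  ext y
  simp [mem_upperSet]

theorem lotteryProb_nonneg {α : Type*} (X T : Finset α) : 0 ≤ lotteryProb X T := by
  unfold lotteryProb; positivity

theorem lotteryProb_le_one {α : Type*} (X T : Finset α) : lotteryProb X T ≤ 1 := by
  unfold lotteryProb
  exact div_le_one_of_le₀ (by exact_mod_cast card_le_card inter_subset_left) (by positivity)

theorem lotteryProb_union {α : Type*} (X : Finset α) {S T : Finset α} (h : Disjoint S T) :
    lotteryProb X (S ∪ T) = lotteryProb X S + lotteryProb X T := by
  unfold lotteryProb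
  rw [← add_div, inter_union_distrib_left,
    card_union_of_disjoint (h.mono inter_subset_right inter_subset_right), Nat.cast_add]

theorem lotteryProb_add_le_one {α : Type*} (X : Finset α) {S T : Finset α} (h : Disjoint S T) :
    lotteryProb X S + lotteryProb X T ≤ 1 :=
  (lotteryProb_union X h).symm.trans_le (lotteryProb_le_one _ _)

theorem lotteryProb_eq_one {α : Type*} {X T : Finset α} (hX : X.Nonempty) (h : X ⊆ T) :
    lotteryProb X T = 1 := by
  unfold lotteryProb
  rw [inter_eq_left.2 h, div_self]
  exact_mod_cast hX.card_pos.ne'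

theorem lotteryProb_add_compl {X : Finset A} (hX : X.Nonempty) (T : Finset A) :
    lotteryProb X T + lotteryProb X Tᶜ = 1 := by
  rw [← lotteryProb_union X disjoint_compl_right, union_compl]
  exact lotteryProb_eq_one hX (subset_univ _)

theorem lotteryProb_pos_iff {α : Type*} {X T : Finset α} :
    0 < lotteryProb X T ↔ (X ∩ T).Nonempty := by
  unfold lotteryProb
  constructor
  · intro h
    by_contra hn
    rw [not_nonempty_iff_eq_empty.1 hn] at h
    simp at h
  · intro h
    have h1 := h.card_pos
    have h2 := (h.mono inter_subset_left).card_pos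
    positivity

theorem lotteryProb_eq_one_iff {X T : Finset A} (hX : X.Nonempty) :
    lotteryProb X T = 1 ↔ X ⊆ T := by
  refine ⟨fun h x hx => ?_, lotteryProb_eq_one hX⟩
  by_contra hn
  have h1 : 0 < lotteryProb X Tᶜ := lotteryProb_pos_iff.2 ⟨x, by simp [hx, hn]⟩
  linarith [lotteryProb_add_compl hX T]

theorem half_le_lotteryProb_pair {α : Type*} {X : Finset α} {a b : α}
    (h : X ⊆ {a, b}) (ha : a ∈ X) :
    1 / 2 ≤ lotteryProb X {a} := by
  unfold lotteryProb
  have h1 : X.card ≤ 2 := (card_le_card h).trans card_le_two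
  have h2 : X ∩ {a} = {a} := inter_eq_right.2 (by simpa using ha)
  have h3 : 0 < X.card := card_pos.2 ⟨a, ha⟩
  rw [h2, card_singleton, div_le_div_iff₀ (by norm_num) (by exact_mod_cast h3)]
  norm_num
  exact_mod_cast h1

theorem exists_eq_pair_of_half_le {α : Type*} {X : Finset α} {a : α}
    (h : 1 / 2 ≤ lotteryProb X {a}) :
    ∃ y, X = {a, y} := by
  have hne : (X ∩ {a}).Nonempty := lotteryProb_pos_iff.1 (by linarith)
  have ha : a ∈ X := by
    obtain ⟨x, hx⟩ := hne
    rw [mem_inter, mem_singleton] at hx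
    exact hx.2 ▸ hx.1
  have h2 : X ∩ {a} = {a} := inter_eq_right.2 (by simpa using ha)
  have h3 : 0 < X.card := card_pos.2 ⟨a, ha⟩
  unfold lotteryProb at h
  rw [h2, card_singleton, div_le_div_iff₀ (by norm_num) (by exact_mod_cast h3)] at h
  have h4 : X.card ≤ 2 := by
    have : (X.card : ℝ) ≤ 2 := by simpa using h
    exact_mod_cast this
  rcases Nat.lt_or_ge X.card 2 with h5 | h5
  · obtain ⟨z, rfl⟩ := card_eq_one.1 (by omega : X.card = 1)
    rw [mem_singleton] at ha
    exact ⟨z, by simp [ha]⟩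
  · obtain ⟨x, y, -, rfl⟩ := card_eq_two.1 (by omega : X.card = 2)
    rcases mem_insert.1 ha with rfl | hay
    · exact ⟨y, rfl⟩
    · rw [mem_singleton] at hay
      subst hay
      exact ⟨x, pair_comm _ _⟩

theorem eq_pair_of_half_le {α : Type*} {X : Finset α} {a b : α} (hab : a ≠ b)
    (ha : 1 / 2 ≤ lotteryProb X {a}) (hb : 1 / 2 ≤ lotteryProb X {b}) : X = {a, b} := by
  obtain ⟨y, rfl⟩ := exists_eq_pair_of_half_le ha
  obtain ⟨x, hx⟩ := lotteryProb_pos_iff.1 (by linarith : 0 < lotteryProb {a, y} {b})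
  simp only [mem_inter, mem_insert, mem_singleton] at hx
  obtain ⟨rfl | rfl, rfl⟩ := hx
  · exact absurd rfl hab
  · rfl

/-! ### Stochastic dominance -/

theorem strictSDset_of_forall_rel (r : WeakPref A) {X Y : Finset A} (hX : X.Nonempty)
    (h : ∀ x ∈ X, ∀ y ∈ Y, r.rel x y)
    (hs : ∃ x ∈ X, ∃ y ∈ Y, ¬ r.rel y x) : StrictSDset r.rel X Y := by
  obtain ⟨x, hx, y, hy, hyx⟩ := hs
  have hY : Y.Nonempty := ⟨y, hy⟩
  have key : ∀ z, (∃ w ∈ Y, r.rel w z) → lotteryProb X (upperSet r.rel z) = 1 := by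
    rintro z ⟨w, hw, hwz⟩
    exact lotteryProb_eq_one hX fun v hv => mem_upperSet.2 (r.trans (h v hv w hw) hwz)
  have key' : ∀ z, ¬ (∃ w ∈ Y, r.rel w z) → lotteryProb Y (upperSet r.rel z) = 0 := by
    intro z hz
    refine le_antisymm (not_lt.1 fun hlt => hz ?_) (lotteryProb_nonneg _ _)
    obtain ⟨w, hw⟩ := lotteryProb_pos_iff.1 hlt
    rw [mem_inter, mem_upperSet] at hw
    exact ⟨w, hw⟩
  refine ⟨fun z => ?_, x, ?_⟩ <;> rw [setProb_eq, setProb_eq]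
  · by_cases hz : ∃ w ∈ Y, r.rel w z
    · rw [key z hz]; exact lotteryProb_le_one _ _
    · rw [key' z hz]; exact lotteryProb_nonneg _ _
  · by_cases hz : ∃ w ∈ Y, r.rel w x
    · rw [key x hz]
      refine lt_of_le_of_ne (lotteryProb_le_one _ _) fun he => hyx ?_
      exact mem_upperSet.1 ((lotteryProb_eq_one_iff hY).1 he hy)
    · rw [key' x hz]
      refine lotteryProb_pos_iff.2 ⟨x, mem_inter.2 ⟨hx, mem_upperSet.2 ?_⟩⟩
      exact (r.total x x).elim id id

theorem WeakPref.refl {α : Type*} (r : WeakPref α) (x : α) : r.rel x x := (r.total x x).elim id id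

theorem lotteryProb_pair {α : Type*} {a b : α} (hab : a ≠ b) (T : Finset α) :
    lotteryProb {a, b} T = ((if a ∈ T then 1 else 0) + (if b ∈ T then 1 else 0)) / 2 := by
  unfold lotteryProb
  rw [card_pair hab]
  by_cases ha : a ∈ T <;> by_cases hb : b ∈ T <;>
    simp [ha, hb, insert_inter_of_mem, insert_inter_of_notMem, card_pair hab,
      singleton_inter_of_mem, singleton_inter_of_notMem]

theorem strictSDset_pair (r : WeakPref A) {a u y : A} (h : ¬ r.rel y u) :
    StrictSDset r.rel {a, u} {a, y} := by
  have huy : r.rel u y := (r.total u y).resolve_right h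
  by_cases hua : u = a
  · subst hua
    apply strictSDset_of_forall_rel
    · simp
    · simp [huy, r.refl]
    · exact ⟨u, by simp, y, by simp, h⟩
  by_cases hya : y = a
  · subst hya
    apply strictSDset_of_forall_rel
    · simp
    · simp [huy, r.refl]
    · exact ⟨u, by simp, y, by simp, h⟩
  refine ⟨fun z => ?_, u, ?_⟩ <;>
    rw [setProb_eq, setProb_eq, lotteryProb_pair (Ne.symm hua), lotteryProb_pair (Ne.symm hya)] <;>
    simp only [mem_upperSet]
  · have : r.rel y z → r.rel u z := fun hyz => r.trans huy hyz
    gcongr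
    split_ifs with h1 h2 <;> simp_all
  · simp only [h, r.refl, if_true, if_false]
    linarith

/-- If the pair `{b, s}` with `b` on top does not dominate `X`, and `X` puts at most half of its
mass strictly above `s`, then exactly half of the mass of `X` is on top. -/
theorem lotteryProb_tops_eq_half (r : WeakPref A) {b s : A} {X : Finset A}
    (hb : b ∈ tops r.rel) (hs : s ∉ tops r.rel) (hX : ¬ StrictSDset r.rel {b, s} X)
    (h : ∀ x, ¬ r.rel s x → lotteryProb X (upperSet r.rel x) ≤ 1 / 2) :
    lotteryProb X (tops r.rel) = 1 / 2 := by
  have hbs : b ≠ s := by rintro rfl; exact hs hb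
  have hsb : ¬ r.rel s b := fun hsb => hs (mem_tops.2 fun y => r.trans hsb (mem_tops.1 hb y))
  have hu : upperSet r.rel b = tops r.rel := by
    ext y
    rw [mem_upperSet, mem_tops]
    exact ⟨fun hy z => r.trans hy (mem_tops.1 hb z), fun hy => hy b⟩
  refine le_antisymm (hu ▸ h b hsb) (not_lt.1 fun hlt => hX ⟨fun z => ?_, b, ?_⟩) <;>
    rw [setProb_eq, setProb_eq, lotteryProb_pair hbs] <;> simp only [mem_upperSet]
  · rw [if_pos (mem_tops.1 hb z)]
    by_cases hz : r.rel s z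
    · rw [if_pos hz]; linarith [lotteryProb_le_one X (upperSet r.rel z)]
    · rw [if_neg hz]; linarith [h z hz]
  · rw [hu, if_pos (r.refl b), if_neg hsb]
    linarith

set_option linter.unusedSectionVars false

/-! ### Concrete preferences -/

namespace WeakPref

/-- The set of least preferred alternatives. -/
noncomputable def bots (r : WeakPref A) : Finset A :=
  Finset.univ.filter (fun y => ∀ x, r.rel x y)

theorem mem_bots {r : WeakPref A} {y : A} : y ∈ r.bots ↔ ∀ x, r.rel x y := by
  simp [bots]

/-- The preference that ranks alternatives by increasing `u`. -/
def ofRank {α : Type*} (u : α → ℕ) : WeakPref α where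
  rel x y := u x ≤ u y
  total _ _ := le_total _ _
  trans := le_trans

/-- The dichotomous preference with tops `T`. -/
noncomputable def dich {α : Type*} (T : Finset α) : WeakPref α :=
  ofRank fun x => if x ∈ T then 0 else 1

/-- The preference with `a` first, `b` second, and everything else last. -/
noncomputable def ord {α : Type*} (a b : α) : WeakPref α :=
  ofRank fun x => if x = a then 0 else if x = b then 1 else 2

/-- The preference with `a` first, `b` last, and everything else in between. -/
noncomputable def extremes {α : Type*} (a b : α) : WeakPref α :=
  ofRank fun x => if x = a then 0 else if x = b then 2 else 1

section rel
variable {α : Type*}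

theorem dich_rel {T : Finset α} {x y : α} : (dich T).rel x y ↔ (y ∈ T → x ∈ T) := by
  by_cases hx : x ∈ T <;> by_cases hy : y ∈ T <;> simp [dich, ofRank, hx, hy]

theorem ord_rel {a b x y : α} :
    (ord a b).rel x y ↔ x = a ∨ (y ≠ a ∧ (x = b ∨ y ≠ b)) := by
  simp only [ord, ofRank]
  grind

theorem extremes_rel {a b x y : α} :
    (extremes a b).rel x y ↔ x = a ∨ (y ≠ a ∧ (y = b ∨ x ≠ b)) := by
  simp only [extremes, ofRank]
  grind

end rel

theorem exists_max {α : Type*} (r : WeakPref α) {S : Finset α} (hS : S.Nonempty) :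
    ∃ s ∈ S, ∀ x ∈ S, r.rel s x := by
  induction hS using Finset.Nonempty.cons_induction with
  | singleton a => exact ⟨a, by simp, by simp [r.refl]⟩
  | cons a S ha hS ih =>
    obtain ⟨s, hs, h⟩ := ih
    rcases r.total a s with has | hsa
    · refine ⟨a, by simp, fun x hx => ?_⟩
      rcases mem_cons.1 hx with rfl | hx
      · exact r.refl _
      · exact r.trans has (h x hx)
    · refine ⟨s, by simp [hs], fun x hx => ?_⟩
      rcases mem_cons.1 hx with rfl | hx
      · exact hsa
      · exact h x hx

theorem tops_dich {T : Finset A} (hT : T.Nonempty) : tops (dich T).rel = T := by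
  ext x
  rw [mem_tops]
  obtain ⟨t, ht⟩ := hT
  exact ⟨fun h => dich_rel.1 (h t) ht, fun h y => dich_rel.2 fun _ => h⟩

theorem tops_ord (a b : A) : tops (ord a b).rel = {a} := by
  ext x
  simp only [mem_tops, mem_singleton]
  exact ⟨fun h => by simpa [ord_rel] using h a, fun h y => ord_rel.2 (Or.inl h)⟩

theorem bots_dich {T : Finset A} (hT : T ≠ univ) : (dich T).bots = Tᶜ := by
  ext x
  rw [mem_bots, mem_compl]
  obtain ⟨t, ht⟩ : ∃ t, t ∉ T := by simpa [Finset.ext_iff] using hT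
  exact ⟨fun h hx => ht (dich_rel.1 (h t) hx), fun h y => dich_rel.2 fun h' => absurd h' h⟩

theorem bots_ord {a b c : A} (hac : c ≠ a) (hbc : c ≠ b) : (ord a b).bots = {a, b}ᶜ := by
  ext x
  simp only [mem_bots, mem_compl, mem_insert, mem_singleton, not_or]
  constructor
  · intro h
    simpa [ord_rel, hac, hbc] using h c
  · exact fun h y => ord_rel.2 (by simp [h.1, h.2])

theorem bots_extremes {a b : A} (hab : a ≠ b) : (extremes a b).bots = {b} := by
  ext x
  simp only [mem_bots, mem_singleton]
  constructor
  · intro h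
    have := extremes_rel.1 (h b)
    grind
  · rintro rfl y
    exact extremes_rel.2 (by simp [hab.symm])

end WeakPref

open WeakPref

/-! ### Basic consequences of strategyproofness -/

/-- A nonempty-valued, weakly strategyproof and ex post efficient choice rule. -/
structure Admissible (f : (V → WeakPref A) → Finset A) : Prop where
  nonempty : ∀ R, (f R).Nonempty
  sp : WeakSPset f
  eff : ExPostEffSet f

/-- Move from `R` to `R'` by changing the voters one at a time. -/
theorem profile_induction {α : Type*} {P : (V → α) → Prop} {R R' : V → α} (h0 : P R)
    (hstep : ∀ Q i, (∀ j, Q j = R j ∨ Q j = R' j) → Q i = R i → P Q →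
      P (Function.update Q i (R' i))) : P R' := by
  have key : ∀ S : Finset V, P (fun j => if j ∈ S then R' j else R j) := by
    intro S
    induction S using Finset.induction_on with
    | empty => simpa using h0
    | insert i S hi ih =>
      have := hstep _ i (fun j => by by_cases hj : j ∈ S <;> simp [hj]) (by simp [hi]) ih
      convert this using 1
      ext1 j
      by_cases hj : j = i
      · subst hj; simp
      · simp [hj]
  simpa using key univ

namespace Admissible

variable {f : (V → WeakPref A) → Finset A}

theorem not_strict_update (hf : Admissible f) (Q : V → WeakPref A) (i : V) (r : WeakPref A) :
    ¬ StrictSDset (Q i).rel (f (Function.update Q i r)) (f Q) :=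
  hf.sp Q _ i fun j hj => by simp [hj]

theorem subset_of_tops (hf : Admissible f) {R R' : V → WeakPref A} {T : Finset A}
    (h : ∀ i, R i = R' i ∨ tops (R' i).rel = T) (hR : f R ⊆ T) : f R' ⊆ T := by
  refine profile_induction (R := R) (R' := R') (P := fun Q => f Q ⊆ T) hR fun Q i _ hi hQ => ?_
  rcases h i with h | h
  · rwa [← h, ← hi, Function.update_eq_self]
  by_contra hn
  obtain ⟨y, hy, hyT⟩ := not_subset.1 hn
  refine hf.sp (Function.update Q i (R' i)) Q i (fun j hj => by simp [hj]) ?_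
  rw [Function.update_self]
  obtain ⟨x, hx⟩ := hf.nonempty Q
  have hm : ∀ x ∈ f Q, ∀ y, (R' i).rel x y := fun x hx => mem_tops.1 (h ▸ hQ hx)
  refine strictSDset_of_forall_rel _ ⟨x, hx⟩ (fun x hx y _ => hm x hx y)
    ⟨x, hx, y, hy, fun hyx => ?_⟩
  exact hyT (h ▸ mem_tops.2 fun z => (R' i).trans hyx (hm x hx z))

theorem subset_of_bots (hf : Admissible f) {R R' : V → WeakPref A} {B : Finset A}
    (h : ∀ i, R i = R' i ∨ (R i).bots = B) (hR : f R ⊆ B) : f R' ⊆ B := by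
  refine profile_induction (R := R) (R' := R') (P := fun Q => f Q ⊆ B) hR fun Q i _ hi hQ => ?_
  rcases h i with h | h
  · rwa [← h, ← hi, Function.update_eq_self]
  by_contra hn
  obtain ⟨y, hy, hyB⟩ := not_subset.1 hn
  refine hf.sp Q (Function.update Q i (R' i)) i (fun j hj => by simp [hj]) ?_
  rw [hi]
  obtain ⟨x, hx⟩ := hf.nonempty Q
  have hm : ∀ x ∈ f Q, ∀ y, (R i).rel y x := fun x hx => mem_bots.1 (h ▸ hQ hx)
  refine strictSDset_of_forall_rel _ ⟨y, hy⟩ (fun y _ x hx => hm x hx y)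
    ⟨y, hy, x, hx, fun hxy => ?_⟩
  exact hyB (h ▸ mem_bots.2 fun z => (R i).trans (hm x hx z) hxy)

theorem lotteryProb_le_of_dich (hf : Admissible f) {R R' : V → WeakPref A} {T : Finset A}
    (h : ∀ i, R i = R' i ∨ R i = dich T) : lotteryProb (f R') T ≤ lotteryProb (f R) T := by
  refine profile_induction (R := R) (R' := R')
    (P := fun Q => lotteryProb (f Q) T ≤ lotteryProb (f R) T) le_rfl fun Q i _ hi hQ => ?_
  rcases h i with h | h
  · rwa [← h, ← hi, Function.update_eq_self]
  refine le_trans (not_lt.1 fun hlt => ?_) hQ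
  refine hf.sp Q (Function.update Q i (R' i)) i (fun j hj => by simp [hj]) ?_
  rw [hi, h]
  obtain ⟨t, ht⟩ : (f (Function.update Q i (R' i)) ∩ T).Nonempty :=
    lotteryProb_pos_iff.1 ((lotteryProb_nonneg _ _).trans_lt hlt)
  have hT : upperSet (dich T).rel t = T := by
    ext x
    rw [mem_upperSet, dich_rel]
    exact ⟨fun h => h (mem_inter.1 ht).2, fun h _ => h⟩
  refine ⟨fun z => ?_, t, ?_⟩ <;> rw [setProb_eq, setProb_eq]
  · by_cases hz : z ∈ T
    · have hT : upperSet (dich T).rel z = T := by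
        ext x
        rw [mem_upperSet, dich_rel]
        exact ⟨fun h => h hz, fun h _ => h⟩
      rw [hT]
      exact hlt.le
    · rw [lotteryProb_eq_one (hf.nonempty (Function.update Q i (R' i))) fun x _ => ?_]
      · exact lotteryProb_le_one _ _
      · rw [mem_upperSet, dich_rel]
        exact fun h => absurd h hz
  · rwa [hT]

/-- Efficiency, in the form in which every alternative other than `x` and `y` is discarded. -/
theorem subset_pair (hf : Admissible f) {R : V → WeakPref A} {x y : A}
    (h : ∀ z, z ≠ x → z ≠ y → ∃ w, (∀ i, (R i).rel w z) ∧ ∃ i, ¬ (R i).rel z w) :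
    f R ⊆ {x, y} := by
  intro z hz
  by_contra hn
  simp only [mem_insert, mem_singleton, not_or] at hn
  exact hf.eff R z (h z hn.1 hn.2) hz

theorem eq_singleton (hf : Admissible f) {R : V → WeakPref A} {x : A}
    (h : ∀ z, z ≠ x → z ∉ f R) : f R = {x} :=
  eq_singleton_iff_nonempty_unique_mem.2
    ⟨hf.nonempty R, fun z hz => by_contra fun hn => h z hn hz⟩

theorem eq_singleton_of_dominates (hf : Admissible f) {R : V → WeakPref A} {x : A}
    (h : ∀ z, z ≠ x → (∀ i, (R i).rel x z) ∧ ∃ i, ¬ (R i).rel z x) : f R = {x} :=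
  hf.eq_singleton fun z hz => hf.eff R z ⟨x, h z hz⟩

theorem eq_singleton_of_subset (hf : Admissible f) {R : V → WeakPref A} {x : A}
    (h : f R ⊆ {x}) : f R = {x} :=
  (subset_singleton_iff.1 h).resolve_left (hf.nonempty R).ne_empty

/-- If `f` stays within `{b, x}` on all intermediate profiles, then voters who strictly prefer `b`
to `x` cannot move the choice away from `{x}`. -/
theorem eq_singleton_of_mix (hf : Admissible f) {R R' : V → WeakPref A} {b x : A}
    (hR : f R = {x})
    (hmem : ∀ Q : V → WeakPref A, (∀ j, Q j = R j ∨ Q j = R' j) → f Q ⊆ {b, x})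
    (h : ∀ i, R i = R' i ∨ ((R i).rel b x ∧ ¬ (R i).rel x b)) : f R' = {x} := by
  by_cases hbx : b = x
  · subst hbx
    exact hf.eq_singleton_of_subset (by simpa using hmem R' fun j => Or.inr rfl)
  refine (profile_induction (R := R) (R' := R')
    (P := fun Q => (∀ j, Q j = R j ∨ Q j = R' j) ∧ f Q = {x}) ⟨fun j => Or.inl rfl, hR⟩
    fun Q i hQ' hi hQ => ?_).2
  have hmix : ∀ j, Function.update Q i (R' i) j = R j ∨ Function.update Q i (R' i) j = R' j := by
    intro j
    by_cases hj : j = i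
    · subst hj; simp
    · simpa [hj] using hQ' j
  refine ⟨hmix, ?_⟩
  rcases h i with h | ⟨h, h'⟩
  · rw [← h, ← hi, Function.update_eq_self]; exact hQ.2
  have hs := hmem _ hmix
  refine hf.eq_singleton fun z hz hzf => ?_
  have hzb : z = b := by simpa [hz] using hs hzf
  subst hzb
  refine hf.sp Q (Function.update Q i (R' i)) i (fun j hj => by simp [hj]) ?_
  rw [hi, hQ.2]
  refine strictSDset_of_forall_rel _ ⟨z, hzf⟩ (fun w hw v hv => ?_) ⟨z, hzf, x, by simp, h'⟩
  rw [mem_singleton] at hv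
  subst hv
  rcases mem_insert.1 (hs hw) with rfl | hw
  · exact h
  · rw [mem_singleton] at hw
    subst hw
    exact WeakPref.refl _ _

end Admissible

/-! ### Forcing coalitions -/

/-- Whenever all members of `G` have `x` as their unique top, `x` alone is chosen. -/
def ForcesTop (f : (V → WeakPref A) → Finset A) (G : Finset V) : Prop :=
  ∀ R x, (∀ i ∈ G, tops (R i).rel = {x}) → f R = {x}

/-- Members of `G` report `p`, the others report `q`. -/
noncomputable def splitProfile {α β : Type*} (G : Finset α) (p q : β) : α → β :=
  fun i => if i ∈ G then p else q

theorem splitProfile_of_mem {α β : Type*} {G : Finset α} {p q : β} {i : α} (h : i ∈ G) :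
    splitProfile G p q i = p := if_pos h

theorem splitProfile_of_notMem {α β : Type*} {G : Finset α} {p q : β} {i : α} (h : i ∉ G) :
    splitProfile G p q i = q := if_neg h

theorem ne_dich_univ_of_ne {a b : A} (h : b ≠ a) : ({a} : Finset A) ≠ univ := fun he =>
  h (mem_singleton.1 (he.symm ▸ mem_univ b))

namespace Admissible

variable {f : (V → WeakPref A) → Finset A}

theorem forcesTop_univ [Nonempty V] (hf : Admissible f) : ForcesTop f univ := by
  intro R x h
  obtain ⟨i⟩ := ‹Nonempty V›
  have ht : ∀ i, ∀ z, (R i).rel x z := fun i => mem_tops.1 (by simp [h i])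
  refine hf.eq_singleton_of_dominates fun z hz => ⟨fun i => ht i z, i, fun hzx => hz ?_⟩
  rw [← mem_singleton, ← h i (mem_univ i), mem_tops]
  exact fun w => (R i).trans hzx (ht i w)

theorem not_forcesTop_empty (hA : 1 < Fintype.card A) : ¬ ForcesTop f ∅ := by
  intro h
  obtain ⟨a, b, hab⟩ := Fintype.one_lt_card_iff.1 hA
  have ha := h (fun _ => dich ∅) a (by simp)
  rw [h (fun _ => dich ∅) b (by simp)] at ha
  exact hab (singleton_injective ha).symm

/-- If `f R₀ = {b}` although `b` is the unique bottom of everyone outside `G`, then `G` can force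
`b`. -/
theorem eq_singleton_of_bots (hf : Admissible f) {G : Finset V} {R₀ R : V → WeakPref A} {b : A}
    (h₀ : f R₀ = {b}) (hG : ∀ i ∉ G, (R₀ i).bots = {b}) (hR : ∀ i ∈ G, tops (R i).rel = {b}) :
    f R = {b} := by
  have h1 : f (fun i => if i ∈ G then R i else R₀ i) ⊆ {b} := by
    refine hf.subset_of_tops (fun i => ?_) h₀.subset
    by_cases hi : i ∈ G
    · right; simpa [hi] using hR i hi
    · left; simp [hi]
  refine hf.eq_singleton_of_subset (hf.subset_of_bots (fun i => ?_) h1)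
  by_cases hi : i ∈ G
  · left; simp [hi]
  · right; simpa [hi] using hG i hi

theorem forces_of_notMem (hf : Admissible f) {G : Finset V} {a b : A} (hba : b ≠ a)
    (hG : G.Nonempty) (hGc : Gᶜ.Nonempty)
    (h : a ∉ f (splitProfile G (dich {a}) (dich {a}ᶜ))) {R : V → WeakPref A}
    (hR : ∀ i ∈ Gᶜ, tops (R i).rel = {b}) : f R = {b} := by
  obtain ⟨g, hg⟩ := hG
  obtain ⟨g', hg'⟩ := hGc
  rw [mem_compl] at hg'
  have hab := hba.symm
  have h1 : f (splitProfile G (ord a b) (dich {a}ᶜ)) = {b} := by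
    have ha : f (splitProfile G (ord a b) (dich {a}ᶜ)) ⊆ {a}ᶜ := by
      refine hf.subset_of_bots (fun i => ?_) (R := splitProfile G (dich {a}) (dich {a}ᶜ)) ?_
      · by_cases hi : i ∈ G
        · right; rw [splitProfile_of_mem hi, bots_dich (ne_dich_univ_of_ne hba)]
        · left; simp [splitProfile, hi]
      · intro x hx
        rw [mem_compl, mem_singleton]
        rintro rfl
        exact h hx
    refine hf.eq_singleton fun z hz hzf => ?_
    have hza : z ≠ a := by simpa using ha hzf
    refine hf.eff _ z ⟨b, fun i => ?_, g, ?_⟩ hzf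
    · by_cases hi : i ∈ G <;> simp [splitProfile, hi, ord_rel, dich_rel, hza, hba]
    · simp [splitProfile, hg, ord_rel, hz, hza, hba]
  have h2 : f (splitProfile G (ord a b) (dich {b})) = {b} := by
    refine hf.eq_singleton_of_subset (hf.subset_of_tops (fun i => ?_) h1.subset)
    by_cases hi : i ∈ G
    · left; simp [splitProfile, hi]
    · right; rw [splitProfile_of_notMem hi, tops_dich (by simp)]
  have h3 : f (splitProfile G (dich {a}) (dich {b})) = {b} := by
    refine hf.eq_singleton_of_mix (b := a) h2 (fun Q hQ => ?_) fun i => ?_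
    · refine hf.subset_pair fun z hza hzb => ⟨b, fun i => ?_, g', ?_⟩
      · by_cases hi : i ∈ G <;>
          rcases hQ i with h | h <;> simp [h, splitProfile, hi, ord_rel, dich_rel, hza, hba]
      · rcases hQ g' with h | h <;> simp [h, splitProfile, hg', dich_rel, hzb]
    · by_cases hi : i ∈ G <;> simp [splitProfile, hi, ord_rel, hba]
  have h4 : f (splitProfile G (extremes a b) (dich {b})) = {b} := by
    have ha : f (splitProfile G (extremes a b) (dich {b})) ⊆ {a}ᶜ := by
      refine hf.subset_of_bots (fun i => ?_) (R := splitProfile G (dich {a}) (dich {b})) ?_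
      · by_cases hi : i ∈ G
        · right; rw [splitProfile_of_mem hi, bots_dich (ne_dich_univ_of_ne hba)]
        · left; simp [splitProfile, hi]
      · simp [h3, hab]
    refine hf.eq_singleton fun z hz hzf => ?_
    have hza : z ≠ a := by simpa using ha hzf
    refine hf.eff _ z ⟨a, fun i => ?_, g, ?_⟩ hzf
    · by_cases hi : i ∈ G <;> simp [splitProfile, hi, extremes_rel, dich_rel, hz]
    · simp [splitProfile, hg, extremes_rel, hz, hza]
  refine hf.eq_singleton_of_bots h4 (fun i hi => ?_) hR
  rw [mem_compl, not_not] at hi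
  rw [splitProfile_of_mem hi, bots_extremes hab]

theorem exists_ne_ne (hm : 3 ≤ Fintype.card A) (a b : A) : ∃ c, c ≠ a ∧ c ≠ b := by
  by_contra! h
  have : (univ : Finset A) ⊆ {a, b} := fun c _ => by
    by_cases hc : c = a
    · simp [hc]
    · simp [h c hc]
  have h2 := (card_le_card this).trans card_le_two
  rw [card_univ] at h2
  omega

theorem forcesTop_compl (hm : 3 ≤ Fintype.card A) [Nonempty V] (hf : Admissible f) {G : Finset V}
    {a : A} (h : a ∉ f (splitProfile G (dich {a}) (dich {a}ᶜ))) : ForcesTop f Gᶜ := by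
  rcases G.eq_empty_or_nonempty with rfl | hG
  · simpa using hf.forcesTop_univ
  rcases (Gᶜ).eq_empty_or_nonempty with hGc | hGc
  · refine absurd ?_ h
    rw [compl_eq_empty_iff] at hGc
    rw [hf.forcesTop_univ _ a fun i _ => ?_]
    · simp
    · rw [splitProfile_of_mem (by simp [hGc]), tops_dich (by simp)]
  have key : ∀ b ≠ a, ∀ R, (∀ i ∈ Gᶜ, tops (R i).rel = {b}) → f R = {b} := by
    intro b hb R hR
    exact hf.forces_of_notMem hb hG hGc h hR
  intro R x hR
  rcases ne_or_eq x a with hx | rfl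
  · exact key x hx R hR
  obtain ⟨b, hb, -⟩ := exists_ne_ne hm x x
  obtain ⟨c, hcx, hcb⟩ := exists_ne_ne hm x b
  refine hf.forces_of_notMem hb.symm hG hGc (fun hbf => ?_) hR
  have h1 : f (splitProfile G (dich {b}) (dich {c})) = {c} := key c hcx _ fun i hi => by
    rw [splitProfile_of_notMem (mem_compl.1 hi), tops_dich (by simp)]
  have h2 : f (splitProfile G (dich {b}) (dich {b}ᶜ)) ⊆ {b}ᶜ := by
    refine hf.subset_of_tops (R := splitProfile G (dich {b}) (dich {c})) (fun i => ?_) ?_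
    · by_cases hi : i ∈ G
      · left; simp [splitProfile, hi]
      · right; rw [splitProfile_of_notMem hi, tops_dich ⟨c, by simp [hcb]⟩]
    · simp [h1, hcb.symm]
  simpa using h2 hbf

/-- If `Gᶜ` is not forcing, then `G` can guarantee any alternative probability at least one
half. -/
theorem half_le_lotteryProb (hm : 3 ≤ Fintype.card A) [Nonempty V] (hf : Admissible f)
    {G : Finset V} (hN : ¬ ForcesTop f Gᶜ) {b : A} {R : V → WeakPref A}
    (hR : ∀ i ∈ G, R i = dich {b}) : 1 / 2 ≤ lotteryProb (f R) {b} := by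
  have hb : ∀ b, b ∈ f (splitProfile G (dich {b}) (dich {b}ᶜ)) := fun b =>
    by_contra fun h => hN (hf.forcesTop_compl hm h)
  rcases G.eq_empty_or_nonempty with rfl | ⟨g, hg⟩
  · simp [hf.forcesTop_univ] at hN
  obtain ⟨x, hx, -⟩ := exists_ne_ne hm b b
  have h1 : f (splitProfile G (ord b x) (dich {b}ᶜ)) ⊆ {b, x} := by
    refine hf.subset_pair fun z hzb hzx => ⟨x, fun i => ?_, g, ?_⟩
    · by_cases hi : i ∈ G <;> simp [splitProfile, hi, ord_rel, dich_rel, hzb, hx]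
    · simp [splitProfile, hg, ord_rel, hzb, hzx, hx]
  have h2 : b ∈ f (splitProfile G (ord b x) (dich {b}ᶜ)) := by
    by_contra hbf
    have h3 : f (splitProfile G (ord b x) (dich {b}ᶜ)) = {x} := hf.eq_singleton fun z hz hzf => by
      rcases mem_insert.1 (h1 hzf) with rfl | h
      · exact hbf hzf
      · exact hz (mem_singleton.1 h)
    have h4 : f (splitProfile G (ord b x) (ord x b)) = {x} := by
      refine hf.eq_singleton_of_subset (hf.subset_of_tops (fun i => ?_) h3.subset)
      by_cases hi : i ∈ G
      · left; simp [splitProfile, hi]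
      · right; rw [splitProfile_of_notMem hi, tops_ord]
    have h5 : f (splitProfile G (dich {b}) (ord x b)) = {x} := by
      rcases (Gᶜ).eq_empty_or_nonempty with hGc | ⟨g', hg'⟩
      · exfalso
        rw [hf.forcesTop_univ _ b fun i _ => ?_] at h3
        · exact hx (singleton_injective h3).symm
        · rw [splitProfile_of_mem (by simp [(compl_eq_empty_iff _).1 hGc]), tops_ord]
      rw [mem_compl] at hg'
      refine hf.eq_singleton_of_mix (b := b) h4 (fun Q hQ => ?_) fun i => ?_
      · refine hf.subset_pair fun z hzb hzx => ⟨x, fun i => ?_, g', ?_⟩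
        · by_cases hi : i ∈ G <;>
            rcases hQ i with h | h <;> simp [h, splitProfile, hi, ord_rel, dich_rel, hzb, hx]
        · rcases hQ g' with h | h <;> simp [h, splitProfile, hg', ord_rel, hzx]
      · by_cases hi : i ∈ G <;> simp [splitProfile, hi, ord_rel, hx]
    have h6 : f (splitProfile G (dich {b}) (dich {b}ᶜ)) ⊆ {b}ᶜ := by
      refine hf.subset_of_tops (R := splitProfile G (dich {b}) (ord x b)) (fun i => ?_) ?_
      · by_cases hi : i ∈ G
        · left; simp [splitProfile, hi]
        · right; rw [splitProfile_of_notMem hi, tops_dich ⟨x, by simp [hx]⟩]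
      · simp [h5, hx.symm]
    simpa using h6 (hb b)
  have h3 := half_le_lotteryProb_pair h1 h2
  have h4 : 1 / 2 ≤ lotteryProb (f (splitProfile G (dich {b}) (dich {b}ᶜ))) {b} := by
    refine h3.trans (hf.lotteryProb_le_of_dich fun i => ?_)
    by_cases hi : i ∈ G <;> simp [splitProfile, hi]
  have h5 : lotteryProb (f R) {b}ᶜ ≤
      lotteryProb (f (splitProfile G (dich {b}) (dich {b}ᶜ))) {b}ᶜ := by
    refine hf.lotteryProb_le_of_dich fun i => ?_
    by_cases hi : i ∈ G
    · left; simp [splitProfile, hi, hR]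
    · right; simp [splitProfile, hi]
  linarith [lotteryProb_add_compl (hf.nonempty R) {b},
    lotteryProb_add_compl (hf.nonempty (splitProfile G (dich {b}) (dich {b}ᶜ))) {b}]

theorem subset_of_forcesTop (hf : Admissible f) {G : Finset V} (hG : ForcesTop f G)
    {R : V → WeakPref A} {a : A} {T : Finset A} (ha : a ∈ T)
    (hR : ∀ i ∈ G, tops (R i).rel = {a} ∨ tops (R i).rel = T) : f R ⊆ T := by
  have h1 : f (fun i => if i ∈ G ∧ tops (R i).rel = T then dich {a} else R i) = {a} := by
    refine hG _ a fun i hi => ?_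
    by_cases h : tops (R i).rel = T
    · simp only [hi, h, and_self, if_true]
      exact tops_dich (by simp)
    · simpa [h] using (hR i hi).resolve_right h
  refine hf.subset_of_tops (fun i => ?_) (h1.subset.trans (by simpa using ha))
  by_cases h : i ∈ G ∧ tops (R i).rel = T
  · exact Or.inr h.2
  · left; rw [if_neg h]

end Admissible

/-! ### Intersections of forcing coalitions -/

theorem subset_singleton_of_notMem {α : Type*} {X : Finset α} {x y : α} (h : X ⊆ {x, y})
    (hy : y ∉ X) : X ⊆ {x} := by
  rwa [pair_comm, subset_insert_iff_of_notMem hy] at h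

theorem eq_of_subset_pair {α : Type*} {X : Finset α} {x y : α} (h : X ⊆ {x, y}) (hX : X.Nonempty) :
    X = {x} ∨ X = {y} ∨ X = {x, y} := by
  by_cases hx : x ∈ X
  · by_cases hy : y ∈ X
    · exact Or.inr (Or.inr (h.antisymm (by simp [insert_subset_iff, hx, hy])))
    · exact Or.inl
        ((subset_singleton_iff.1 (subset_singleton_of_notMem h hy)).resolve_left hX.ne_empty)
  · rw [subset_insert_iff_of_notMem hx] at h
    exact Or.inr (Or.inl ((subset_singleton_iff.1 h).resolve_left hX.ne_empty))

theorem eq_of_not_strictSDset {r r' : WeakPref A} {x y : A} {X Y : Finset A}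
    (hX : X.Nonempty) (hY : Y.Nonempty) (hX' : X ⊆ {x, y}) (hY' : Y ⊆ {x, y})
    (h : r.rel x y ∧ ¬ r.rel y x) (h' : r'.rel x y ∧ ¬ r'.rel y x)
    (hr : ¬ StrictSDset r.rel X Y) (hr' : ¬ StrictSDset r'.rel Y X) : X = Y := by
  have h1 : ∀ r : WeakPref A, ¬ r.rel y x → StrictSDset r.rel {x} {x, y} := fun r h => by
    simpa using strictSDset_pair (a := x) r h
  have h2 : ∀ r : WeakPref A, ¬ r.rel y x → StrictSDset r.rel {x, y} {y} := fun r h => by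
    simpa [pair_comm] using strictSDset_pair (a := y) r h
  have h3 : ∀ r : WeakPref A, r.rel x y → ¬ r.rel y x → StrictSDset r.rel {x} {y} := fun r h h' =>
    strictSDset_of_forall_rel r (by simp) (by simpa using h) (by simpa using h')
  rcases eq_of_subset_pair hX' hX with rfl | rfl | rfl <;>
    rcases eq_of_subset_pair hY' hY with rfl | rfl | rfl <;> simp_all

/-- Members of `M` report `p`, further members of `K` report `q`, the others report `r`. -/
noncomputable def threeProfile {α β : Type*} (M K : Finset α) (p q r : β) : α → β :=
  fun k => if k ∈ M then p else if k ∈ K then q else r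

theorem threeProfile_swap {M K : Finset V} {β : Type*} (p q r : β) :
    threeProfile M (M ∪ K)ᶜ p q r = threeProfile M K p r q := by
  ext1 k
  by_cases h : k ∈ M <;> by_cases h' : k ∈ K <;> simp [threeProfile, h, h']

theorem tops_dich_singleton (a : A) : tops (dich {a}).rel = {a} := tops_dich (by simp)

theorem tops_dich_pair (a b : A) : tops (dich {a, b}).rel = {a, b} := tops_dich (by simp)

namespace Admissible

variable {f : (V → WeakPref A) → Finset A}

/-- If `f` stays within `{x, y}` on all intermediate profiles, and all voters who change their
report strictly prefer `x` to `y` before and after, then the choice does not change. -/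
theorem eq_of_mix (hf : Admissible f) {R R' : V → WeakPref A} {x y : A}
    (hmem : ∀ Q : V → WeakPref A, (∀ j, Q j = R j ∨ Q j = R' j) → f Q ⊆ {x, y})
    (h : ∀ i, R i = R' i ∨ (((R i).rel x y ∧ ¬ (R i).rel y x) ∧
      ((R' i).rel x y ∧ ¬ (R' i).rel y x))) : f R' = f R := by
  refine (profile_induction (R := R) (R' := R')
    (P := fun Q => (∀ j, Q j = R j ∨ Q j = R' j) ∧ f Q = f R) ⟨fun j => Or.inl rfl, rfl⟩
    fun Q i hQ' hi hQ => ?_).2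
  have hmix : ∀ j, Function.update Q i (R' i) j = R j ∨ Function.update Q i (R' i) j = R' j := by
    intro j
    by_cases hj : j = i
    · subst hj; simp
    · simpa [hj] using hQ' j
  refine ⟨hmix, ?_⟩
  rcases h i with h | ⟨h, h'⟩
  · rw [← h, ← hi, Function.update_eq_self]; exact hQ.2
  rw [← hQ.2]
  refine eq_of_not_strictSDset (hf.nonempty _) (hf.nonempty _) (hmem _ hmix) (hmem _ hQ') h h' ?_ ?_
  · rw [← hi]
    exact hf.sp _ _ i fun j hj => by simp [hj]
  · have := hf.sp (Function.update Q i (R' i)) Q i fun j hj => by simp [hj]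
    rwa [Function.update_self] at this

/-- No partition of the voters into `M`, `{i}` and the rest has all three pairwise unions
forcing. -/
theorem not_forcesTop_of_forcesTop (hm : 3 ≤ Fintype.card A) (hf : Admissible f)
    {M : Finset V} {i : V} (hi : i ∉ M) (hMi : ForcesTop f (M ∪ {i})) (hMO : ForcesTop f {i}ᶜ) :
    ¬ ForcesTop f Mᶜ := by
  intro hOi
  obtain ⟨a, b, c, hab, hac, hbc⟩ := Fintype.two_lt_card_iff.1 hm
  have hba := hab.symm
  have hca := hac.symm
  have hcb := hbc.symm
  have s1 : f (threeProfile M {i} (dich {a, c}) (dich {b, c}) (ord b a)) ⊆ {b, c} := by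
    refine hf.subset_of_forcesTop hOi (a := b) (by simp) fun k hk => ?_
    by_cases hki : k = i <;>
      simp [threeProfile, mem_compl.1 hk, hki, hi, tops_ord, tops_dich_pair]
  have s23 : ∀ Q : V → WeakPref A,
      (∀ k, Q k = threeProfile M {i} (dich {a, c}) (ord b c) (ord a b) k ∨
        Q k = threeProfile M {i} (dich {a, c}) (ord c b) (ord a b) k) → f Q ⊆ {c, a} := by
    intro Q hQ
    rw [pair_comm]
    refine hf.subset_of_forcesTop hMO (a := a) (by simp) fun k hk => ?_
    have hki : k ≠ i := by simpa using hk
    have hQ := hQ k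
    by_cases hkM : k ∈ M <;> simp only [threeProfile, hkM, hki, mem_singleton, if_true, if_false,
      or_self] at hQ <;> simp [hQ, tops_ord, tops_dich_pair]
  have s34 : ∀ Q : V → WeakPref A,
      (∀ k, Q k = threeProfile M {i} (dich {a, c}) (ord c b) (ord a b) k ∨
        Q k = threeProfile M {i} (dich {a, c}) (ord c b) (ord b a) k) → f Q ⊆ {a, c} := by
    intro Q hQ
    refine hf.subset_of_forcesTop hMi (a := c) (by simp) fun k hk => ?_
    have hQ := hQ k
    rcases mem_union.1 hk with hk | hk
    · simp only [threeProfile, hk, if_true, or_self] at hQ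
      simp [hQ, tops_dich_pair]
    · obtain rfl := mem_singleton.1 hk
      simp only [threeProfile, hi, if_false, hk, if_true, or_self] at hQ
      simp [hQ, tops_ord]
  have s56 : ∀ Q : V → WeakPref A,
      (∀ k, Q k = threeProfile M {i} (dich {c}) (dich {b, c}) (ord a b) k ∨
        Q k = threeProfile M {i} (dich {c}) (dich {b, c}) (ord b a) k) → f Q ⊆ {b, c} := by
    intro Q hQ
    refine hf.subset_of_forcesTop hMi (a := c) (by simp) fun k hk => ?_
    have hQ := hQ k
    rcases mem_union.1 hk with hk | hk
    · simp only [threeProfile, hk, if_true, or_self] at hQ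
      simp [hQ, tops_dich_singleton]
    · obtain rfl := mem_singleton.1 hk
      simp only [threeProfile, hi, if_false, hk, if_true, or_self] at hQ
      simp [hQ, tops_dich_pair]
  have h8 : f (threeProfile M {i} (dich {c}) (ord b c) (ord b a)) = {b} := by
    refine hOi _ b fun k hk => ?_
    by_cases hki : k = i <;> simp [threeProfile, mem_compl.1 hk, hki, hi, tops_ord]
  have e23 := hf.eq_of_mix s23 fun k => by
    by_cases hkM : k ∈ M <;> by_cases hki : k = i <;>
      simp [threeProfile, hkM, hki, hi, ord_rel, hab, hac, hca, hcb]
  have e34 := hf.eq_of_mix s34 fun k => by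
    by_cases hkM : k ∈ M <;> by_cases hki : k = i <;>
      simp [threeProfile, hkM, hki, hi, ord_rel, hab, hac, hca, hcb]
  have e56 := hf.eq_of_mix s56 fun k => by
    by_cases hkM : k ∈ M <;> by_cases hki : k = i <;>
      simp [threeProfile, hkM, hki, hi, ord_rel, hba, hca, hcb]
  have s4 := s34 _ fun k => Or.inr rfl
  have s6 := s56 _ fun k => Or.inr rfl
  have hc : c ∈ f (threeProfile M {i} (dich {a, c}) (ord c b) (ord b a)) := by
    by_contra hc
    have h1 : f (threeProfile M {i} (dich {a, c}) (dich {b, c}) (ord b a)) ⊆ {c, b}ᶜ := by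
      refine hf.subset_of_bots (R := threeProfile M {i} (dich {a, c}) (ord c b) (ord b a))
        (fun k => ?_) ?_
      · by_cases hkM : k ∈ M <;> by_cases hki : k = i <;>
          simp [threeProfile, hkM, hki, hi, bots_ord hac hab]
      · exact (subset_singleton_of_notMem s4 hc).trans (by simp [hac, hab])
    obtain ⟨z, hz⟩ := hf.nonempty (threeProfile M {i} (dich {a, c}) (dich {b, c}) (ord b a))
    exact mem_compl.1 (h1 hz) ((pair_comm b c).subset (s1 hz))
  have ha : a ∈ f (threeProfile M {i} (dich {a, c}) (ord c b) (ord b a)) := by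
    by_contra ha
    have h2 : f (threeProfile M {i} (dich {a, c}) (ord b c) (ord a b)) ⊆ {c} := by
      rw [← e23, ← e34]
      exact (subset_insert_iff_of_notMem ha).1 s4
    have h7 : f (threeProfile M {i} (dich {c}) (ord b c) (ord a b)) ⊆ {a, b}ᶜ := by
      refine (hf.subset_of_tops (fun k => ?_) h2).trans (by simp [hca, hcb])
      by_cases hkM : k ∈ M <;> simp [threeProfile, hkM, tops_dich_singleton]
    have h8' : f (threeProfile M {i} (dich {c}) (ord b c) (ord b a)) ⊆ {a, b}ᶜ := by
      refine hf.subset_of_bots (fun k => ?_) h7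
      by_cases hkM : k ∈ M <;> by_cases hki : k = i <;>
        simp [threeProfile, hkM, hki, bots_ord hca hcb]
    simp [h8] at h8'
  have h4 : f (threeProfile M {i} (dich {a, c}) (ord c b) (ord b a)) = {c, a} :=
    (s4.trans (pair_comm a c).subset).antisymm (by simp [insert_subset_iff, ha, hc])
  have h1 : f (threeProfile M {i} (dich {a, c}) (dich {b, c}) (ord b a)) = {b} := by
    have hc1 : c ∉ f (threeProfile M {i} (dich {a, c}) (dich {b, c}) (ord b a)) := by
      intro hc1
      obtain ⟨u, hu, hu'⟩ : ∃ u, f (threeProfile M {i} (dich {a, c}) (dich {b, c}) (ord b a)) =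
          {c, u} ∧ (u = b ∨ u = c) := by
        rcases eq_of_subset_pair s1 (hf.nonempty _) with h | h | h
        · simp [h, hcb] at hc1
        · exact ⟨c, by simp [h], Or.inr rfl⟩
        · exact ⟨b, by rw [h, pair_comm], Or.inl rfl⟩
      refine hf.sp (threeProfile M {i} (dich {a, c}) (ord c b) (ord b a))
        (threeProfile M {i} (dich {a, c}) (dich {b, c}) (ord b a)) i
        (fun k hk => by simp [threeProfile, hk]) ?_
      rw [h4, hu]
      refine strictSDset_pair _ ?_
      rcases hu' with rfl | rfl <;> simp [threeProfile, ord_rel, *]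
    exact hf.eq_singleton_of_subset (subset_singleton_of_notMem s1 hc1)
  have h6 : f (threeProfile M {i} (dich {c}) (dich {b, c}) (ord b a)) = {b} := by
    have h6' : f (threeProfile M {i} (dich {c}) (dich {b, c}) (ord b a)) ⊆ {a, c}ᶜ := by
      have hu : ({a, c} : Finset A) ≠ univ := fun he => by
        have h := mem_univ b
        rw [← he] at h
        simp [hba, hbc] at h
      refine hf.subset_of_bots
        (R := threeProfile M {i} (dich {a, c}) (dich {b, c}) (ord b a)) (fun k => ?_)
        (by simp [h1, hba, hbc])
      by_cases hkM : k ∈ M <;> simp [threeProfile, hkM, bots_dich hu]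
    exact hf.eq_singleton_of_subset
      (subset_singleton_of_notMem s6 fun hc => by simpa using h6' hc)
  have h7 : f (threeProfile M {i} (dich {c}) (ord b c) (ord a b)) ⊆ {c}ᶜ := by
    refine (hf.subset_of_tops (fun k => ?_) (e56 ▸ h6).subset).trans (by simp [hcb])
    by_cases hkM : k ∈ M <;> by_cases hki : k = i <;> simp [threeProfile, hkM, hki, hi, tops_ord]
  have h2 : f (threeProfile M {i} (dich {a, c}) (ord b c) (ord a b)) ⊆ {c}ᶜ := by
    refine hf.subset_of_bots (fun k => ?_) h7
    by_cases hkM : k ∈ M <;> simp [threeProfile, hkM, bots_dich (ne_dich_univ_of_ne hac)]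
  rw [← e23, ← e34] at h2
  simpa using h2 hc

theorem exists_eq_pair (hm : 3 ≤ Fintype.card A) [Nonempty V] (hf : Admissible f)
    {M : Finset V} (hM : ¬ ForcesTop f Mᶜ) {a : A} {R : V → WeakPref A}
    (hR : ∀ k ∈ M, R k = dich {a}) : ∃ y, f R = {a, y} :=
  exists_eq_pair_of_half_le (hf.half_le_lotteryProb hm hM hR)

theorem pair_mono (hm : 3 ≤ Fintype.card A) [Nonempty V] (hf : Admissible f)
    {M : Finset V} (hM : ¬ ForcesTop f Mᶜ) {a y : A} {R R' : V → WeakPref A} {w : WeakPref A}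
    (hR : ∀ k ∈ M, R k = dich {a}) (hR' : ∀ k, R k = R' k ∨ (k ∉ M ∧ R' k = w))
    (h : f R = {a, y}) : ∃ y', f R' = {a, y'} ∧ w.rel y' y := by
  refine (profile_induction (R := R) (R' := R')
    (P := fun Q => (∀ k ∈ M, Q k = dich {a}) ∧ ∃ y', f Q = {a, y'} ∧ w.rel y' y)
    ⟨hR, y, h, w.refl y⟩ fun Q i _ hi hQ => ?_).2
  obtain ⟨hQM, y', hy', hyy'⟩ := hQ
  rcases hR' i with h | ⟨hiM, hw⟩
  · rw [← h, ← hi, Function.update_eq_self]; exact ⟨hQM, y', hy', hyy'⟩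
  have hQM' : ∀ k ∈ M, Function.update Q i (R' i) k = dich {a} := fun k hk => by
    rw [Function.update_of_ne (by rintro rfl; exact hiM hk), hQM k hk]
  refine ⟨hQM', ?_⟩
  obtain ⟨z, hz⟩ := hf.exists_eq_pair hm hM hQM'
  refine ⟨z, hz, w.trans ?_ hyy'⟩
  by_contra hn
  refine hf.sp (Function.update Q i (R' i)) Q i (fun j hj => by simp [hj]) ?_
  rw [Function.update_self, hw, ← hw, hz, hy', hw]
  exact strictSDset_pair w hn

theorem pair_right_injective {a x y : A} (h : ({a, x} : Finset A) = {a, y}) : x = y := by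
  have h1 : x ∈ ({a, y} : Finset A) := h ▸ by simp
  have h2 : y ∈ ({a, x} : Finset A) := h ▸ by simp
  grind

theorem threeProfile_eq_pair (hm : 3 ≤ Fintype.card A) [Nonempty V] (hf : Admissible f)
    {M K : Finset V} (hM : ¬ ForcesTop f M) (hM' : ¬ ForcesTop f Mᶜ) (hK : ForcesTop f Kᶜ)
    {a b c : A} (hab : a ≠ b) (hac : a ≠ c) (hbc : b ≠ c) :
    f (threeProfile M K (dich {a}) (ord b c) (ord c a)) = {a, c} := by
  have h1 : f (threeProfile M K (dich {a}) (dich {c}) (dich {c})) = {a, c} := by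
    refine eq_pair_of_half_le hac (hf.half_le_lotteryProb hm hM' fun k hk => ?_)
      (hf.half_le_lotteryProb hm (G := Mᶜ) (by rwa [compl_compl]) fun k hk => ?_)
    · simp [threeProfile, hk]
    · simp [threeProfile, mem_compl.1 hk]
  obtain ⟨y, h2, hy⟩ := hf.pair_mono hm hM' (w := ord c a)
    (R' := threeProfile M K (dich {a}) (dich {c}) (ord c a))
    (fun k hk => by simp [threeProfile, hk])
    (fun k => by by_cases hkM : k ∈ M <;> by_cases hk : k ∈ K <;> simp [threeProfile, hkM, hk]) h1
  obtain rfl : y = c := by simpa [ord_rel] using hy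
  obtain ⟨z, h3, hz⟩ := hf.pair_mono hm hM' (w := ord b y)
    (R' := threeProfile M K (dich {a}) (ord b y) (ord y a))
    (fun k hk => by simp [threeProfile, hk])
    (fun k => by by_cases hkM : k ∈ M <;> by_cases hk : k ∈ K <;> simp [threeProfile, hkM, hk]) h2
  have h4 : f (threeProfile M K (dich {a}) (ord b y) (dich {a})) = {a, a} := by
    rw [pair_eq_singleton]
    refine hK _ a fun k hk => ?_
    by_cases hkM : k ∈ M <;> simp [threeProfile, hkM, mem_compl.1 hk, tops_dich_singleton]
  obtain ⟨x, h5, hx⟩ := hf.pair_mono hm hM' (w := ord y a)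
    (R' := threeProfile M K (dich {a}) (ord b y) (ord y a))
    (fun k hk => by simp [threeProfile, hk])
    (fun k => by by_cases hkM : k ∈ M <;> by_cases hk : k ∈ K <;> simp [threeProfile, hkM, hk]) h4
  obtain rfl : z = x := pair_right_injective (h3.symm.trans h5)
  rw [ord_rel] at hz hx
  rw [h3]
  grind

/-- If neither `M` nor `Mᶜ` is forcing, then `Mᶜ` cannot be partitioned into `K` and `K'` such that
both `M ∪ K` and `M ∪ K'` are forcing. -/
theorem not_forcesTop_union (hm : 3 ≤ Fintype.card A) [Nonempty V] (hf : Admissible f)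
    {M K : Finset V} (hM : ¬ ForcesTop f M) (hM' : ¬ ForcesTop f Mᶜ) (hK : ForcesTop f Kᶜ) :
    ¬ ForcesTop f (M ∪ K) := by
  intro hMK
  obtain ⟨a, b, c, hab, hac, hbc⟩ := Fintype.two_lt_card_iff.1 hm
  have h1 := hf.threeProfile_eq_pair hm hM hM' hK hab hac hbc
  have h2 := hf.threeProfile_eq_pair hm hM hM' (K := (M ∪ K)ᶜ) (by rwa [compl_compl])
    hac hab hbc.symm
  rw [threeProfile_swap] at h2
  obtain ⟨y, h3, hy⟩ := hf.pair_mono hm hM' (w := ord c b)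
    (R' := threeProfile M K (dich {a}) (ord b c) (ord c b))
    (fun k hk => by simp [threeProfile, hk])
    (fun k => by by_cases hkM : k ∈ M <;> by_cases hk : k ∈ K <;> simp [threeProfile, hkM, hk]) h1
  obtain ⟨z, h4, hz⟩ := hf.pair_mono hm hM' (w := ord b c)
    (R' := threeProfile M K (dich {a}) (ord b c) (ord c b))
    (fun k hk => by simp [threeProfile, hk])
    (fun k => by by_cases hkM : k ∈ M <;> by_cases hk : k ∈ K <;> simp [threeProfile, hkM, hk]) h2
  obtain rfl : y = c := by simpa [ord_rel] using hy
  obtain rfl : z = b := by simpa [ord_rel] using hz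
  exact hbc (pair_right_injective (h4.symm.trans h3))

theorem forcesTop_erase (hm : 3 ≤ Fintype.card A) [Nonempty V] (hf : Admissible f)
    {G : Finset V} {i : V} (hi : ForcesTop f {i}ᶜ) (hG : ForcesTop f G) :
    ForcesTop f (G.erase i) := by
  by_cases hiG : i ∈ G
  · by_contra hM
    have hMi : ForcesTop f (G.erase i ∪ {i}) := by
      convert hG using 1
      ext j
      by_cases hj : j = i <;> simp [hj, hiG]
    exact hf.not_forcesTop_union hm hM
      (hf.not_forcesTop_of_forcesTop hm (by simp) hMi hi) hi hMi
  · rwa [erase_eq_of_notMem hiG]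

end Admissible

/-! ### Two voters -/

theorem tops_nonempty [Nonempty A] (r : WeakPref A) : (tops r.rel).Nonempty := by
  obtain ⟨s, -, hs⟩ := r.exists_max (univ_nonempty (α := A))
  exact ⟨s, mem_tops.2 fun y => hs y (mem_univ y)⟩

namespace Admissible

variable {f : (V → WeakPref A) → Finset A}

theorem mem_tops_of_eq_singleton (hm : 3 ≤ Fintype.card A) (hf : Admissible f) {i j : V}
    (hij : i ≠ j) (hi : ¬ ForcesTop f {i}ᶜ) (hj : ¬ ForcesTop f {j}ᶜ) {R : V → WeakPref A} {s : A}
    (h : f R = {s}) (hs : s ∈ tops (R i).rel) : s ∈ tops (R j).rel := by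
  have : Nonempty V := ⟨i⟩
  have : Nonempty A := ⟨s⟩
  by_contra hsj
  obtain ⟨b, hb⟩ := tops_nonempty (R j)
  have hsb : s ≠ b := by rintro rfl; exact hsj hb
  have h1 : f (Function.update R i (dich {s})) = {s} := by
    refine hf.eq_singleton_of_subset (hf.subset_of_tops (fun k => ?_) h.subset)
    by_cases hk : k = i
    · subst hk; right; simp [tops_dich_singleton]
    · left; simp [hk]
  have h2 : f (Function.update (Function.update R i (dich {s})) j (dich {b})) = {s, b} := by
    refine eq_pair_of_half_le hsb (hf.half_le_lotteryProb hm hi fun k hk => ?_)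
      (hf.half_le_lotteryProb hm hj fun k hk => ?_)
    · obtain rfl := mem_singleton.1 hk; simp [hij]
    · obtain rfl := mem_singleton.1 hk; simp
  refine hf.not_strict_update (Function.update R i (dich {s})) j (dich {b}) ?_
  rw [h1, h2, Function.update_of_ne hij.symm]
  have := strictSDset_pair (R j) (a := s) (u := b) (y := s) fun hsb =>
    hsj (mem_tops.2 fun y => (R j).trans hsb (mem_tops.1 hb y))
  simpa using this

/-- If `i` reports `dich S` and `S` is disjoint from the tops of `j`, then `S` gets at most half of
the probability. -/
theorem lotteryProb_le_half (hm : 3 ≤ Fintype.card A) (hf : Admissible f) {i j : V}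
    (hij : i ≠ j) (hi : ¬ ForcesTop f {i}ᶜ) (hj : ¬ ForcesTop f {j}ᶜ) {R : V → WeakPref A}
    {S : Finset A} (hR : R i = dich S) (hS : S.Nonempty) (hd : Disjoint S (tops (R j).rel)) :
    lotteryProb (f R) S ≤ 1 / 2 := by
  have : Nonempty A := ⟨hS.choose⟩
  by_contra! hlt
  set R₁ : V → WeakPref A := fun k => if k = i ∨ k = j then R k else dich S with hR₁
  have hi₁ : R₁ i = dich S := by simp [hR₁, hR]
  have hj₁ : R₁ j = R j := by simp [hR₁]
  have hlt₁ : 1 / 2 < lotteryProb (f R₁) S := by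
    refine hlt.trans_le (hf.lotteryProb_le_of_dich fun k => ?_)
    by_cases hk : k = i ∨ k = j
    · left; simp only [hR₁, hk, if_true]
    · right; simp only [hR₁, hk, if_false]
  obtain ⟨s, hs, hmax⟩ := (R j).exists_max hS
  obtain ⟨b, hb⟩ := tops_nonempty (R j)
  have hsj : s ∉ tops (R j).rel := fun h => disjoint_left.1 hd hs h
  have hbS : b ∉ S := fun h => disjoint_left.1 hd h hb
  have hsb : s ≠ b := by rintro rfl; exact hsj hb
  have h2 : f (Function.update R₁ j (ord b s)) ⊆ {b, s} := by
    refine hf.subset_pair fun z hzb hzs => ⟨s, fun k => ?_, j, ?_⟩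
    · by_cases hk : k = j
      · subst hk; simp [ord_rel, hzb]
      · by_cases hki : k = i
        · subst hki; simp [hk, hi₁, dich_rel, hs]
        · simp [hk, hki, hR₁, dich_rel, hs]
    · simp [ord_rel, hzb, hzs, hsb]
  have h2' : f (Function.update R₁ j (ord b s)) = {b, s} := by
    rcases eq_of_subset_pair h2 (hf.nonempty _) with h | h | h
    · have := hf.mem_tops_of_eq_singleton hm hij.symm hj hi h (by simp [tops_ord])
      rw [Function.update_of_ne hij, hi₁, tops_dich hS] at this
      exact absurd this hbS
    · have := hf.mem_tops_of_eq_singleton hm hij hi hj h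
        (by rwa [Function.update_of_ne hij, hi₁, tops_dich hS])
      rw [Function.update_self, tops_ord, mem_singleton] at this
      exact absurd this hsb
    · exact h
  have h3 := hf.not_strict_update R₁ j (ord b s)
  rw [h2', hj₁] at h3
  have h4 := lotteryProb_tops_eq_half (R j) hb hsj h3 fun x hx => by
    have hdx : Disjoint S (upperSet (R j).rel x) := disjoint_left.2 fun z hzS hzx =>
      hx ((R j).trans (hmax z hzS) (mem_upperSet.1 hzx))
    linarith [lotteryProb_add_le_one (f R₁) hdx]
  linarith [lotteryProb_add_le_one (f R₁) hd]

theorem half_le_lotteryProb_tops (hm : 3 ≤ Fintype.card A) (hf : Admissible f) {i j : V}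
    (hij : i ≠ j) (hi : ¬ ForcesTop f {i}ᶜ) (hj : ¬ ForcesTop f {j}ᶜ) {R : V → WeakPref A}
    (hd : Disjoint (tops (R i).rel) (tops (R j).rel)) :
    1 / 2 ≤ lotteryProb (f R) (tops (R i).rel) := by
  have : Nonempty A := Fintype.card_pos_iff.1 (by omega)
  by_contra! hlt
  set T := tops (R i).rel with hT
  set R₁ : V → WeakPref A := fun k => if k = i ∨ k = j then R k else dich Tᶜ with hR₁
  have hi₁ : R₁ i = R i := by simp [hR₁]
  have hj₁ : R₁ j = R j := by simp [hR₁]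
  have hlt₁ : lotteryProb (f R₁) T < 1 / 2 := by
    have : lotteryProb (f R) Tᶜ ≤ lotteryProb (f R₁) Tᶜ := by
      refine hf.lotteryProb_le_of_dich fun k => ?_
      by_cases hk : k = i ∨ k = j
      · left; simp only [hR₁, hk, if_true]
      · right; simp only [hR₁, hk, if_false]
    linarith [lotteryProb_add_compl (hf.nonempty R) T, lotteryProb_add_compl (hf.nonempty R₁) T]
  obtain ⟨z, hz, hmax⟩ := (R i).exists_max (tops_nonempty (R j))
  obtain ⟨a, ha⟩ := tops_nonempty (R i)
  rw [← hT] at ha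
  have hzT : z ∉ T := fun h => disjoint_left.1 hd h hz
  have haj : a ∉ tops (R j).rel := fun h => disjoint_left.1 hd ha h
  have hza : z ≠ a := by rintro rfl; exact haj hz
  have h2 : f (Function.update R₁ i (ord a z)) ⊆ {a, z} := by
    refine hf.subset_pair fun x hxa hxz => ⟨z, fun k => ?_, i, ?_⟩
    · by_cases hk : k = i
      · subst hk; simp [ord_rel, hxa]
      · by_cases hkj : k = j
        · subst hkj; simpa [hk, hj₁] using mem_tops.1 hz x
        · simp [hk, hkj, hR₁, dich_rel, hzT]
    · simp [ord_rel, hxa, hxz, hza]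
  have h2' : f (Function.update R₁ i (ord a z)) = {a, z} := by
    rcases eq_of_subset_pair h2 (hf.nonempty _) with h | h | h
    · have := hf.mem_tops_of_eq_singleton hm hij hi hj h (by simp [tops_ord])
      rw [Function.update_of_ne hij.symm, hj₁] at this
      exact absurd this haj
    · have := hf.mem_tops_of_eq_singleton hm hij.symm hj hi h
        (by rwa [Function.update_of_ne hij.symm, hj₁])
      rw [Function.update_self, tops_ord, mem_singleton] at this
      exact absurd this hza
    · exact h
  have h3 := hf.not_strict_update R₁ i (ord a z)
  rw [h2', hi₁] at h3
  have h4 := lotteryProb_tops_eq_half (R i) ha hzT h3 fun x hx => by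
    set W := upperSet (R i).rel x
    have hW : lotteryProb (f R₁) W ≤ lotteryProb (f (Function.update R₁ i (dich W))) W := by
      refine hf.lotteryProb_le_of_dich fun k => ?_
      by_cases hk : k = i
      · subst hk; simp
      · simp [hk]
    refine hW.trans (hf.lotteryProb_le_half hm hij hi hj (by simp)
      ⟨x, mem_upperSet.2 ((R i).refl x)⟩ ?_)
    rw [Function.update_of_ne hij.symm, hj₁]
    exact disjoint_left.2 fun y hyW hyj =>
      hx ((R i).trans (hmax y hyj) (mem_upperSet.1 hyW))
  linarith

theorem subset_tops_union (hm : 3 ≤ Fintype.card A) (hf : Admissible f) {i j : V}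
    (hij : i ≠ j) (hi : ¬ ForcesTop f {i}ᶜ) (hj : ¬ ForcesTop f {j}ᶜ) (hD : ForcesTop f {i, j})
    (R : V → WeakPref A) : f R ⊆ tops (R i).rel ∪ tops (R j).rel := by
  by_cases hd : Disjoint (tops (R i).rel) (tops (R j).rel)
  · rw [← lotteryProb_eq_one_iff (hf.nonempty R)]
    refine le_antisymm (lotteryProb_le_one _ _) ?_
    rw [lotteryProb_union _ hd]
    linarith [hf.half_le_lotteryProb_tops hm hij hi hj hd,
      hf.half_le_lotteryProb_tops hm hij.symm hj hi hd.symm]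
  obtain ⟨a, hai, haj⟩ := not_disjoint_iff.1 hd
  intro x hx
  by_contra hxn
  rw [mem_union, not_or] at hxn
  obtain ⟨hxi, hxj⟩ := hxn
  set R₁ : V → WeakPref A := fun k => if k = i ∨ k = j then R k else dich {x} with hR₁
  have hi₁ : R₁ i = R i := by simp [hR₁]
  have hj₁ : R₁ j = R j := by simp [hR₁]
  have hx₁ : x ∈ f R₁ := by
    have h1 : lotteryProb (f R) {x} ≤ lotteryProb (f R₁) {x} := by
      refine hf.lotteryProb_le_of_dich fun k => ?_
      by_cases hk : k = i ∨ k = j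
      · left; simp only [hR₁, hk, if_true]
      · right; simp only [hR₁, hk, if_false]
    have h2 : 0 < lotteryProb (f R) {x} := lotteryProb_pos_iff.2 ⟨x, by simp [hx]⟩
    obtain ⟨y, hy⟩ := lotteryProb_pos_iff.1 (h2.trans_le h1)
    rw [mem_inter, mem_singleton] at hy
    exact hy.2 ▸ hy.1
  have h3 : f (Function.update (Function.update R₁ i (dich {a})) j (dich {a})) = {a} := by
    refine hD _ a fun k hk => ?_
    rcases mem_insert.1 hk with rfl | hk
    · simp [hij, tops_dich_singleton]
    · obtain rfl := mem_singleton.1 hk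
      simp [tops_dich_singleton]
  have h2 : f (Function.update R₁ i (dich {a})) ⊆ tops (R j).rel := by
    refine hf.subset_of_tops (fun k => ?_) (h3.subset.trans (by simpa using haj))
    by_cases hk : k = j
    · subst hk; right; rw [Function.update_of_ne hij.symm, hj₁]
    · left; simp [hk]
  have h2' : f (Function.update R₁ i (dich {a})) = {a} := by
    refine hf.eq_singleton_of_subset (subset_singleton_of_notMem (y := x) ?_ fun h => hxj (h2 h))
    refine hf.subset_pair fun z hza hzx => ⟨a, fun k => ?_, i, ?_⟩
    · by_cases hk : k = i
      · subst hk; simp [dich_rel]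
      · by_cases hkj : k = j
        · subst hkj; simpa [hk, hj₁] using mem_tops.1 haj z
        · simp [hk, hkj, hR₁, dich_rel, hzx]
    · simp [dich_rel, hza]
  have h1 : f R₁ ⊆ tops (R i).rel := by
    refine hf.subset_of_tops (fun k => ?_) (h2'.subset.trans (by simpa using hai))
    by_cases hk : k = i
    · subst hk; right; rw [hi₁]
    · left; simp [hk]
  exact hxi (h1 hx₁)

/-! ### The smallest forcing coalition -/

theorem forcesTop_compl_of_forall (hm : 3 ≤ Fintype.card A) [Nonempty V] (hf : Admissible f)
    (S : Finset V) (hS : ∀ i ∈ S, ForcesTop f {i}ᶜ) : ForcesTop f Sᶜ := by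
  induction S using Finset.induction_on with
  | empty => simpa using hf.forcesTop_univ
  | insert i S _ ih =>
    rw [compl_insert]
    exact hf.forcesTop_erase hm (hS i (mem_insert_self _ _))
      (ih fun k hk => hS k (mem_insert_of_mem hk))

theorem eq_or_eq_of_not_forcesTop (hm : 3 ≤ Fintype.card A) (hf : Admissible f) {i j k : V}
    (hi : ¬ ForcesTop f {i}ᶜ) (hj : ¬ ForcesTop f {j}ᶜ) (hk : ¬ ForcesTop f {k}ᶜ)
    (hij : i ≠ j) : k = i ∨ k = j := by
  have : Nonempty V := ⟨i⟩
  by_contra! hn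
  obtain ⟨a, b, c, hab, hac, hbc⟩ := Fintype.two_lt_card_iff.1 hm
  set R : V → WeakPref A := fun l => if l = i then dich {a} else if l = j then dich {b} else dich {c}
    with hR
  have ha := hf.half_le_lotteryProb hm hi (R := R) (b := a) (by simp [hR])
  have hb := hf.half_le_lotteryProb hm hj (R := R) (b := b) (by simp [hR, hij.symm])
  have hc := hf.half_le_lotteryProb hm hk (R := R) (b := c) (by simp [hR, hn.1, hn.2])
  have hle := lotteryProb_le_one (f R) ({a} ∪ ({b} ∪ {c}))
  rw [lotteryProb_union _ (by simp [hab, hac]), lotteryProb_union _ (by simpa using hbc)] at hle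
  linarith

end Admissible

/-- For `m ≥ 3` and `n ≥ 3`, every ex post efficient and weakly strategyproof
even-chance SDS on weak preference profiles is dictatorial or bidictatorial. -/
theorem evenChance_weakSP_exPost_bidictatorial
    (hm : 3 ≤ Fintype.card A) (hn : 3 ≤ Fintype.card V)
    (f : (V → WeakPref A) → Finset A) (hne : ∀ R, (f R).Nonempty)
    (hsp : WeakSPset f) (heff : ExPostEffSet f) :
    (∃ i : V, ∀ R : V → WeakPref A, f R ⊆ tops (R i).rel) ∨
    (∃ i j : V, i ≠ j ∧ ∀ R : V → WeakPref A,
        f R ⊆ tops (R i).rel ∪ tops (R j).rel) := by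
  have hf : Admissible f := ⟨hne, hsp, heff⟩
  have : Nonempty V := Fintype.card_pos_iff.1 (by omega)
  have : Nonempty A := Fintype.card_pos_iff.1 (by omega)
  set N : Finset V := univ.filter fun i => ¬ ForcesTop f {i}ᶜ with hN
  have hNf : ∀ i ∈ N, ¬ ForcesTop f {i}ᶜ := fun i hi => (mem_filter.1 hi).2
  have hF : ForcesTop f N := by
    simpa using hf.forcesTop_compl_of_forall hm Nᶜ fun i hi => by simpa [hN] using hi
  obtain ⟨i, hi⟩ : N.Nonempty := by
    rw [nonempty_iff_ne_empty]
    intro h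
    exact Admissible.not_forcesTop_empty (by omega) (h ▸ hF)
  by_cases h : ∃ j ∈ N, i ≠ j
  · obtain ⟨j, hj, hij⟩ := h
    have hNij : N = {i, j} := by
      ext k
      rw [mem_insert, mem_singleton]
      refine ⟨fun hk => hf.eq_or_eq_of_not_forcesTop hm (hNf i hi) (hNf j hj) (hNf k hk) hij, ?_⟩
      rintro (rfl | rfl) <;> assumption
    exact Or.inr ⟨i, j, hij, hf.subset_tops_union hm hij (hNf i hi) (hNf j hj) (hNij ▸ hF)⟩
  · push Not at h
    refine Or.inl ⟨i, fun R => ?_⟩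
    obtain ⟨a, ha⟩ := tops_nonempty (R i)
    exact hf.subset_of_forcesTop hF ha fun k hk => Or.inr (by rw [h k hk])
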